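/- Let 0 < β < α < π be such that 2β + α < π, set μ := sin(α/2 − β/4) cos(α/2 + 5β/8), and let λ > μ + 2 be any fixed positive number. Assume mK ≤ β / (4(λ + μ + 2) ln((λ + 2μ + 2)/μ)) and that the oscillators are identical, i.e., ω_i = ω for all i (equivalently D(Ω) = 0). Then every solution Θ(t) of the second-order Kuramoto system m θ_i''(t) + θ_i'(t) = ω_i + (K/N) Σ_{j=1}^N sin(θ_j(t) − θ_i(t)) with initial conditions D(Θ(0)) ≤ π − α − β and D(Θ'(0)) < λK achieves the complete phase synchronization asymptotically: lim_{t→∞} (θ_i(t) − θ_j(t)) = 0 for all 1 ≤ i, j ≤ N. -/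

import Mathlib

open Real Filter

/-- The diameter `D(X) = max_{i≠j} (xᵢ - xⱼ)` of a vector `X ∈ ℝ^N`
(realized as the supremum of `xᵢ - xⱼ` over all pairs). -/
noncomputable def diam {n : ℕ} (X : Fin n → ℝ) : ℝ :=
  ⨆ p : Fin n × Fin n, (X p.1 - X p.2)

/-- A finite family of functions stays below a barrier `B` if every member that touches `B`
while all the others lie below `B` has derivative smaller than that of `B`. -/
lemma finite_family_le_barrier {ι : Type*} [Finite ι] {f f' : ι → ℝ → ℝ} {B B' : ℝ → ℝ} {a : ℝ}
    (hf : ∀ i t, a ≤ t → HasDerivAt (f i) (f' i t) t)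
    (hB : ∀ t, a ≤ t → HasDerivAt B (B' t) t)
    (h0 : ∀ i, f i a ≤ B a)
    (htouch : ∀ i t, a ≤ t → (∀ k, f k t ≤ B t) → f i t = B t → f' i t < B' t)
    (i : ι) {b : ℝ} (hab : a ≤ b) : f i b ≤ B b := by
  have hfc : ∀ i, ContinuousOn (f i) (Set.Icc a b) := fun i t ht =>
    (hf i t ht.1).continuousAt.continuousWithinAt
  have hBc : ContinuousOn B (Set.Icc a b) := fun t ht =>
    (hB t ht.1).continuousAt.continuousWithinAt
  have hclosed : IsClosed ({t | ∀ k, f k t ≤ B t} ∩ Set.Icc a b) := by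
    have : {t | ∀ k, f k t ≤ B t} ∩ Set.Icc a b
        = Set.Icc a b ∩ ⋂ k, {t ∈ Set.Icc a b | f k t ≤ B t} := by
      ext t
      simp only [Set.mem_inter_iff, Set.mem_ofPred_eq, Set.mem_iInter]
      exact ⟨fun h => ⟨h.2, fun k => ⟨h.2, h.1 k⟩⟩, fun h => ⟨fun k => (h.2 k).2, h.1⟩⟩
    rw [this]
    exact isClosed_Icc.inter (isClosed_iInter fun k => isClosed_Icc.isClosed_le (hfc k) hBc)
  have hsub : Set.Icc a b ⊆ {t | ∀ k, f k t ≤ B t} := by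
    refine hclosed.Icc_subset_of_forall_exists_gt h0 ?_
    rintro x ⟨hx, hxab⟩ y hy
    have key : ∀ᶠ z in nhdsWithin x (Set.Ioi x), ∀ k, f k z ≤ B z := by
      rw [eventually_all]
      intro k
      rcases (hx k).lt_or_eq with hlt | heq
      · have := ((hf k x hxab.1).continuousAt.eventually_lt
          (hB x hxab.1).continuousAt hlt).filter_mono (nhdsWithin_le_nhds (s := Set.Ioi x))
        exact this.mono fun z hz => hz.le
      · have hd : HasDerivWithinAt (fun z => f k z - B z) (f' k x - B' x) (Set.Ioi x) x :=
          ((hf k x hxab.1).sub (hB x hxab.1)).hasDerivWithinAt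
        have hneg : f' k x - B' x < 0 := sub_neg.2 (htouch k x hxab.1 hx heq)
        have hslope :=
          ((hasDerivWithinAt_iff_tendsto_slope' (by simp)).1 hd).eventually (gt_mem_nhds hneg)
        filter_upwards [hslope, self_mem_nhdsWithin] with z hz hxz
        rw [slope_def_field, div_neg_iff] at hz
        have hxz' : x < z := hxz
        rcases hz with hz | hz <;> linarith
    obtain ⟨z, hz, hzy⟩ := (key.and (Ioc_mem_nhdsGT hy)).exists
    exact ⟨z, hz, hzy⟩
  exact hsub (Set.right_mem_Icc.2 hab) i

/-- Relaxation estimate for `m w' + w = g` with `g ≤ G`. -/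
lemma le_add_exp_of_relaxation {m T G : ℝ} (hm : 0 < m) {w g : ℝ → ℝ}
    (hw : ∀ t, T ≤ t → HasDerivAt w ((g t - w t) / m) t) (hg : ∀ t, T ≤ t → g t ≤ G)
    {t : ℝ} (ht : T ≤ t) : w t ≤ G + (w T - G) * exp (-((t - T) / m)) := by
  have hd : ∀ s, T ≤ s → HasDerivAt (fun s => (w s - G) * exp ((s - T) / m))
      ((g s - w s) / m * exp ((s - T) / m)
        + (w s - G) * (exp ((s - T) / m) * (1 / m))) s := by
    intro s hs
    exact ((hw s hs).sub_const G).mul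
      ((((hasDerivAt_id s).sub_const T).div_const m).exp)
  have hanti : AntitoneOn (fun s => (w s - G) * exp ((s - T) / m)) (Set.Ici T) := by
    refine antitoneOn_of_deriv_nonpos (convex_Ici T)
      (fun s hs => (hd s hs).continuousAt.continuousWithinAt) ?_ ?_
    · intro s hs
      rw [interior_Ici] at hs
      exact (hd s (le_of_lt hs)).differentiableAt.differentiableWithinAt
    · intro s hs
      rw [interior_Ici] at hs
      rw [(hd s (le_of_lt hs)).deriv]
      have hfac : (g s - w s) / m * exp ((s - T) / m)
          + (w s - G) * (exp ((s - T) / m) * (1 / m))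
          = (g s - G) * (exp ((s - T) / m) / m) := by ring
      rw [hfac]
      exact mul_nonpos_of_nonpos_of_nonneg (sub_nonpos.2 (hg s (le_of_lt hs))) (by positivity)
  have h := hanti (Set.mem_Ici.2 le_rfl) (Set.mem_Ici.2 ht) ht
  simp only [sub_self, zero_div, exp_zero, mul_one] at h
  have h2 := mul_le_mul_of_nonneg_right h (exp_pos (-((t - T) / m))).le
  rw [mul_assoc, ← exp_add, add_neg_cancel, exp_zero, mul_one] at h2
  linarith

/-- The difference of the mean-field forces on the oscillators `i` and `j`. -/
noncomputable def forceDiff {N : ℕ} (K : ℝ) (x : Fin N → ℝ) (i j : Fin N) : ℝ :=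
  K / N * ∑ k, sin (x k - x i) - K / N * ∑ k, sin (x k - x j)

lemma forceDiff_le {N : ℕ} {K : ℝ} (hK : 0 < K) (x : Fin N → ℝ) (i j : Fin N) {c : ℝ}
    (h : ∀ k, sin (x k - x i) - sin (x k - x j) ≤ c) : forceDiff K x i j ≤ K * c := by
  have hN : (0 : ℝ) < N := by exact_mod_cast i.pos
  have hs : ∑ k, (sin (x k - x i) - sin (x k - x j)) ≤ N * c := by
    refine (Finset.sum_le_sum fun k _ => h k).trans ?_
    simp
  rw [forceDiff, ← mul_sub, ← Finset.sum_sub_distrib]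
  calc _ ≤ K / N * (N * c) := mul_le_mul_of_nonneg_left hs (by positivity)
    _ = K * c := by field_simp

lemma forceDiff_le_two {N : ℕ} {K : ℝ} (hK : 0 < K) (x : Fin N → ℝ) (i j : Fin N) :
    forceDiff K x i j ≤ K * 2 :=
  forceDiff_le hK x i j fun k => by linarith [sin_le_one (x k - x i), neg_one_le_sin (x k - x j)]

lemma forceDiff_le_of_abs_le {N : ℕ} {K d : ℝ} (hK : 0 < K) (x : Fin N → ℝ) (i j : Fin N)
    (hd : |x i - x j| ≤ d) : forceDiff K x i j ≤ K * d := by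
  refine forceDiff_le hK x i j fun k => ?_
  have hsin := sin_sub_sin (x k - x i) (x k - x j)
  have h1 : |sin ((x k - x i - (x k - x j)) / 2)| ≤ |(x k - x i - (x k - x j)) / 2| :=
    abs_sin_le_abs
  have h2 := abs_cos_le_one ((x k - x i + (x k - x j)) / 2)
  have h3 : |(x k - x i - (x k - x j)) / 2| = |x i - x j| / 2 := by
    rw [abs_div, abs_two, ← abs_neg]
    ring_nf
  calc sin (x k - x i) - sin (x k - x j) ≤ |sin (x k - x i) - sin (x k - x j)| := le_abs_self _
    _ = 2 * |sin ((x k - x i - (x k - x j)) / 2)| * |cos ((x k - x i + (x k - x j)) / 2)| := by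
      rw [hsin, abs_mul, abs_mul, abs_two]
    _ ≤ 2 * (|x i - x j| / 2) * 1 := by
      rw [h3] at h1
      gcongr
    _ ≤ d := by linarith

/-- Contraction of a nearly extremal pair of phases within a half circle. -/
lemma forceDiff_le_neg {N : ℕ} {K ε R : ℝ} (hK : 0 < K) (hε : 0 < ε) (hR : R < π)
    (x : Fin N → ℝ) (i j : Fin N) (hij : ε ≤ x i - x j) (hijπ : x i - x j ≤ π - ε)
    (hup : ∀ k, x k - x i ≤ R / 2 - (x i - x j) / 2)
    (hlow : ∀ k, x j - x k ≤ R / 2 - (x i - x j) / 2) :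
    forceDiff K x i j ≤ K * (-(2 * sin (ε / 2) * cos (R / 2))) := by
  refine forceDiff_le hK x i j fun k => ?_
  have hsin := sin_sub_sin (x k - x i) (x k - x j)
  have e1 : (x k - x i - (x k - x j)) / 2 = -((x i - x j) / 2) := by ring
  rw [e1, sin_neg] at hsin
  have hR0 : 0 ≤ R := by linarith [hup i]
  have hs : sin (ε / 2) ≤ sin ((x i - x j) / 2) :=
    sin_le_sin_of_le_of_le_pi_div_two (by linarith [pi_pos]) (by linarith) (by linarith)
  have hc : cos (R / 2) ≤ cos ((x k - x i + (x k - x j)) / 2) := by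
    rw [← cos_abs ((x k - x i + (x k - x j)) / 2)]
    refine cos_le_cos_of_nonneg_of_le_pi (abs_nonneg _) (by linarith) ?_
    rw [abs_le]
    constructor <;> linarith [hup k, hlow k]
  have hs0 : 0 < sin (ε / 2) := sin_pos_of_pos_of_lt_pi (by linarith) (by linarith)
  have hc0 : 0 < cos (R / 2) := cos_pos_of_mem_Ioo ⟨by linarith [pi_pos], by linarith⟩
  have := mul_le_mul hs hc hc0.le (hs0.le.trans hs)
  rw [hsin]
  linarith

/-- The auxiliary variables `θᵢ + m θᵢ'` contract exponentially towards a diameter `2ε` as long as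
the scaled velocity diameter is at most `ε`. -/
lemma auxiliary_diam_decay {N : ℕ} {m K ω ε Y T : ℝ} (hm : 0 < m) (hK : 0 < K)
    (hε : 0 < ε) (hεY : 2 * ε ≤ Y) (hYπ : Y + 3 * ε < π) {θ v : Fin N → ℝ → ℝ}
    (hθ : ∀ i t, T ≤ t → HasDerivAt (θ i) (v i t) t)
    (hv : ∀ i t, T ≤ t →
      HasDerivAt (v i) ((ω + K / N * ∑ j, sin (θ j t - θ i t) - v i t) / m) t)
    (hvel : ∀ i j t, T ≤ t → m * (v i t - v j t) ≤ ε)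
    (hinit : ∀ i j, θ i T + m * v i T - (θ j T + m * v j T) ≤ Y) :
    ∃ c > 0, ∀ i j t, T ≤ t →
      θ i t + m * v i t - (θ j t + m * v j t) ≤ 2 * ε + (Y - 2 * ε) * exp (-(c * (t - T))) := by
  set κ := K * (2 * sin (ε / 2) * cos ((Y + 3 * ε) / 2)) with hκ
  have hκ0 : 0 < κ := by
    have h1 : 0 < sin (ε / 2) := sin_pos_of_pos_of_lt_pi (by linarith) (by linarith)
    have h2 : 0 < cos ((Y + 3 * ε) / 2) :=
      cos_pos_of_mem_Ioo ⟨by linarith [pi_pos], by linarith⟩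
    positivity
  have hYε : 0 < Y - 2 * ε + 1 := by linarith
  set c := κ / (Y - 2 * ε + 1) with hc
  have hc0 : 0 < c := by positivity
  have hcκ : c * (Y - 2 * ε) < κ := by
    have : c * (Y - 2 * ε + 1) = κ := by rw [hc]; field_simp
    linarith
  refine ⟨c, hc0, fun i j t ht => ?_⟩
  refine finite_family_le_barrier (ι := Fin N × Fin N)
    (f := fun p t => θ p.1 t + m * v p.1 t - (θ p.2 t + m * v p.2 t))
    (f' := fun p t => forceDiff K (fun k => θ k t) p.1 p.2)
    (B := fun t => 2 * ε + (Y - 2 * ε) * exp (-(c * (t - T))))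
    (B' := fun t => (Y - 2 * ε) * (exp (-(c * (t - T))) * (-(c * 1))))
    ?_ ?_ ?_ ?_ (i, j) ht
  · rintro ⟨i, j⟩ t ht
    have h := ((hθ i t ht).add ((hv i t ht).const_mul m)).sub
      ((hθ j t ht).add ((hv j t ht).const_mul m))
    refine h.congr_deriv ?_
    simp only [forceDiff]
    field_simp
    ring
  · intro t _
    exact ((((((hasDerivAt_id t).sub_const T).const_mul c).neg).exp).const_mul
      (Y - 2 * ε)).const_add (2 * ε)
  · rintro ⟨i, j⟩
    simpa using hinit i j
  · rintro ⟨i, j⟩ t ht hall heq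
    simp only at heq ⊢
    have he1 : exp (-(c * (t - T))) ≤ 1 :=
      exp_le_one_iff.2 (neg_nonpos.2 (mul_nonneg hc0.le (sub_nonneg.2 ht)))
    have hE0 : 0 ≤ (Y - 2 * ε) * exp (-(c * (t - T))) :=
      mul_nonneg (by linarith) (exp_pos _).le
    have hEY : (Y - 2 * ε) * exp (-(c * (t - T))) ≤ Y - 2 * ε :=
      mul_le_of_le_one_right (by linarith) he1
    have hforce := forceDiff_le_neg hK hε hYπ (fun k => θ k t) i j
      (by linarith [hvel i j t ht]) (by linarith [hvel j i t ht])
      (fun k => by linarith [hall (k, j), hvel i k t ht, hvel j i t ht])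
      (fun k => by linarith [hall (i, k), hvel k j t ht, hvel j i t ht])
    have hB' := mul_le_mul_of_nonneg_left hEY hc0.le
    linarith

lemma eventually_add_mul_exp_le {a b C c T : ℝ} (hab : a < b) (hc : 0 < c) :
    ∀ᶠ t in atTop, a + C * exp (-(c * (t - T))) ≤ b := by
  have h1 : Tendsto (fun t : ℝ => c * (t - T)) atTop atTop :=
    (tendsto_atTop_add_const_right _ (-T) tendsto_id).const_mul_atTop hc
  have h2 : Tendsto (fun t : ℝ => a + C * exp (-(c * (t - T)))) atTop (nhds (a + C * 0)) :=
    ((tendsto_exp_neg_atTop_nhds_zero.comp h1).const_mul C).const_add a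
  rw [mul_zero, add_zero] at h2
  exact (h2.eventually (gt_mem_nhds hab)).mono fun t ht => ht.le

/-- Velocity differences relax to the size of the force differences. -/
lemma velocity_diff_le {N : ℕ} {m K ω G T : ℝ} (hm : 0 < m) {θ v : Fin N → ℝ → ℝ}
    (hv : ∀ i t, T ≤ t →
      HasDerivAt (v i) ((ω + K / N * ∑ j, sin (θ j t - θ i t) - v i t) / m) t)
    (hG : ∀ i j t, T ≤ t → forceDiff K (fun k => θ k t) i j ≤ G) (i j : Fin N) {t : ℝ}
    (ht : T ≤ t) :
    v i t - v j t ≤ G + (v i T - v j T - G) * exp (-((t - T) / m)) := by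
  refine le_add_exp_of_relaxation (w := fun t => v i t - v j t)
    (g := fun t => forceDiff K (fun k => θ k t) i j) hm (fun s hs => ?_) (hG i j) ht
  refine ((hv i s hs).sub (hv j s hs)).congr_deriv ?_
  simp only [forceDiff]
  ring

/-- Under small inertia, phases that are eventually confined to an arc of length `d` are eventually
confined to an arc of length `8 m K d`. -/
lemma eventually_phase_contraction {N : ℕ} {m K ω d : ℝ} (hm : 0 < m) (hK : 0 < K)
    (hd : 0 < d) (hmK : 2 * (m * K) ≤ 1) (hdπ : d + 8 * (m * K) * d < π) {θ v : Fin N → ℝ → ℝ}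
    (hθ : ∀ i t, 0 ≤ t → HasDerivAt (θ i) (v i t) t)
    (hv : ∀ i t, 0 ≤ t →
      HasDerivAt (v i) ((ω + K / N * ∑ j, sin (θ j t - θ i t) - v i t) / m) t)
    (hconf : ∀ᶠ t in atTop, ∀ i j, θ i t - θ j t ≤ d) :
    ∀ᶠ t in atTop, ∀ i j, θ i t - θ j t ≤ 8 * (m * K) * d := by
  obtain ⟨T, hT0, hT⟩ : ∃ T, 0 ≤ T ∧ ∀ t, T ≤ t → ∀ i j, θ i t - θ j t ≤ d := by
    obtain ⟨a, ha⟩ := eventually_atTop.1 hconf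
    exact ⟨max a 0, le_max_right _ _, fun t ht => ha t ((le_max_left _ _).trans ht)⟩
  have hvelev : ∀ᶠ t in atTop, ∀ i j, v i t - v j t ≤ 2 * (K * d) := by
    rw [eventually_all]
    intro i
    rw [eventually_all]
    intro j
    have hG : ∀ i j t, T ≤ t → forceDiff K (fun k => θ k t) i j ≤ K * d := fun i j t ht =>
      forceDiff_le_of_abs_le hK _ i j
        (abs_le.2 ⟨by linarith [hT t ht j i], hT t ht i j⟩)
    have hKd : 0 < K * d := by positivity
    filter_upwards [eventually_ge_atTop T,
      eventually_add_mul_exp_le (a := K * d) (b := 2 * (K * d)) (C := v i T - v j T - K * d)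
        (c := 1 / m) (T := T) (by linarith) (by positivity)] with t ht hexp
    refine (velocity_diff_le hm (fun i s hs => hv i s (hT0.trans hs)) hG i j ht).trans ?_
    rwa [one_div_mul_eq_div] at hexp
  obtain ⟨S, hST, hS⟩ : ∃ S, T ≤ S ∧ ∀ t, S ≤ t → ∀ i j, v i t - v j t ≤ 2 * (K * d) := by
    obtain ⟨a, ha⟩ := eventually_atTop.1 hvelev
    exact ⟨max a T, le_max_right _ _, fun t ht => ha t ((le_max_left _ _).trans ht)⟩
  obtain ⟨ε, hεdef⟩ : ∃ ε, ε = 2 * (m * K) * d := ⟨_, rfl⟩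
  have hε : 0 < ε := by rw [hεdef]; positivity
  have hεd : ε ≤ d := by rw [hεdef]; exact mul_le_of_le_one_left hd.le hmK
  have hvel : ∀ i j t, S ≤ t → m * (v i t - v j t) ≤ ε := fun i j t ht => by
    rw [hεdef]
    linarith [mul_le_mul_of_nonneg_left (hS t ht i j) hm.le]
  obtain ⟨c, hc, hdecay⟩ := auxiliary_diam_decay (Y := d + ε) hm hK hε (by linarith)
    (by linarith) (fun i t ht => hθ i t (hT0.trans (hST.trans ht)))
    (fun i t ht => hv i t (hT0.trans (hST.trans ht))) hvel
    (fun i j => by linarith [hT S hST i j, hvel i j S le_rfl])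
  filter_upwards [eventually_ge_atTop S,
    eventually_add_mul_exp_le (a := 2 * ε) (b := 3 * ε) (C := d + ε - 2 * ε) (c := c) (T := S)
      (by linarith) hc] with t ht hexp i j
  linarith [hdecay i j t ht, hvel j i t ht]

/-- Phases confined to an arc of length `d`, with `d` less than a half circle by a margin of order
`m K d`, synchronize completely. -/
lemma tendsto_phase_diff_zero_of_confined {N : ℕ} {m K ω d : ℝ} (hm : 0 < m) (hK : 0 < K)
    (hd : 0 < d) (hmK : 8 * (m * K) < 1) (hdπ : d + 8 * (m * K) * d < π)
    {θ v : Fin N → ℝ → ℝ}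
    (hθ : ∀ i t, 0 ≤ t → HasDerivAt (θ i) (v i t) t)
    (hv : ∀ i t, 0 ≤ t →
      HasDerivAt (v i) ((ω + K / N * ∑ j, sin (θ j t - θ i t) - v i t) / m) t)
    (hconf : ∀ᶠ t in atTop, ∀ i j, θ i t - θ j t ≤ d) (i j : Fin N) :
    Tendsto (fun t => θ i t - θ j t) atTop (nhds 0) := by
  have hq : 0 < 8 * (m * K) := by positivity
  have hiter : ∀ n : ℕ, ∀ᶠ t in atTop, ∀ i j, θ i t - θ j t ≤ (8 * (m * K)) ^ n * d := by
    intro n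
    induction n with
    | zero => simpa using hconf
    | succ n ih =>
      have hle : (8 * (m * K)) ^ n * d ≤ d :=
        mul_le_of_le_one_left hd.le (pow_le_one₀ hq.le hmK.le)
      have h := eventually_phase_contraction hm hK (by positivity) (by linarith)
        (by linarith [mul_le_mul_of_nonneg_left hle hq.le]) hθ hv ih
      rwa [← mul_assoc, ← pow_succ'] at h
  have hlim : Tendsto (fun n : ℕ => (8 * (m * K)) ^ n * d) atTop (nhds 0) := by
    simpa using (tendsto_pow_atTop_nhds_zero_of_lt_one hq.le hmK).mul_const d
  rw [Metric.tendsto_nhds]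
  intro r hr
  obtain ⟨n, hn⟩ := (hlim.eventually (gt_mem_nhds hr)).exists
  filter_upwards [hiter n] with t ht
  rw [Real.dist_eq, sub_zero, abs_lt]
  constructor <;> linarith [ht i j, ht j i]

lemma sub_le_diam {n : ℕ} (X : Fin n → ℝ) (i j : Fin n) : X i - X j ≤ diam X :=
  le_ciSup (f := fun p : Fin n × Fin n => X p.1 - X p.2) (Set.finite_range _).bddAbove (i, j)

lemma two_le_log_div {x y : ℝ} (hy : 0 < y) (hxy : 8 * y ≤ x) : 2 ≤ log (x / y) := by
  have hx : 0 < x := by linarith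
  rw [le_log_iff_exp_le (by positivity), le_div_iff₀ hy]
  have he : exp 2 ≤ 8 := by
    have h1 := exp_one_lt_d9
    have h2 : exp 2 = exp 1 * exp 1 := by rw [← exp_add]; norm_num
    rw [h2]
    nlinarith [exp_pos 1]
  exact (mul_le_mul_of_nonneg_right he hy.le).trans hxy

/-- Theorem 1.9 (complete phase synchronization for identical oscillators):
with `μ = sin(α/2 - β/4) cos(α/2 + 5β/8)`, any fixed `λ > μ + 2`, small inertia
`mK` and identical natural frequencies, every solution with
`D(Θ(0)) ≤ π - α - β` and `D(Θ'(0)) < λK` satisfies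
`θᵢ(t) - θⱼ(t) → 0` as `t → ∞` for all `i, j`. -/
theorem kuramoto_phase_synchronization
    (N : ℕ) (hN : 0 < N) (m K : ℝ) (hm : 0 < m) (hK : 0 < K)
    (α β μ lam : ℝ)
    (hβ : 0 < β) (hβα : β < α) (hαπ : α < Real.pi) (hαβπ : 2 * β + α < Real.pi)
    (hμdef : μ = Real.sin (α / 2 - β / 4) * Real.cos (α / 2 + 5 / 8 * β))
    (hlam0 : 0 < lam) (hlam : lam > μ + 2)
    (hmK : m * K ≤ β / (4 * (lam + μ + 2) * Real.log ((lam + 2 * μ + 2) / μ)))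
    (ω : ℝ)
    (θ : Fin N → ℝ → ℝ)
    (hsmooth : ∀ i, ContDiff ℝ 2 (θ i))
    (hode : ∀ i, ∀ t : ℝ, 0 ≤ t →
      m * deriv (deriv (θ i)) t + deriv (θ i) t
        = ω + K / N * ∑ j, Real.sin (θ j t - θ i t))
    (hinit : diam (fun i => θ i 0) ≤ Real.pi - α - β)
    (hinit' : diam (fun i => deriv (θ i) 0) < lam * K) :
    ∀ i j, Tendsto (fun t => θ i t - θ j t) atTop (nhds 0) := by
  have hπ := pi_pos
  have hπ4 := pi_le_four
  have hμ0 : 0 < μ := by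
    rw [hμdef]
    exact mul_pos (sin_pos_of_pos_of_lt_pi (by linarith) (by linarith))
      (cos_pos_of_mem_Ioo ⟨by linarith, by linarith⟩)
  have hμ2 : 2 * μ ≤ 1 := by
    have h := sin_sub_sin (α + 3 / 8 * β) (7 / 8 * β)
    have e1 : (α + 3 / 8 * β - 7 / 8 * β) / 2 = α / 2 - β / 4 := by ring
    have e2 : (α + 3 / 8 * β + 7 / 8 * β) / 2 = α / 2 + 5 / 8 * β := by ring
    rw [e1, e2, mul_assoc, ← hμdef] at h
    have h1 := sin_le_one (α + 3 / 8 * β)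
    have h2 : 0 ≤ sin (7 / 8 * β) :=
      sin_nonneg_of_nonneg_of_le_pi (by linarith) (by linarith)
    linarith
  have hlog : 2 ≤ log ((lam + 2 * μ + 2) / μ) := two_le_log_div hμ0 (by linarith)
  have hmK0 : 0 < m * K := mul_pos hm hK
  have hsmall : m * K * (lam + μ + 2) ≤ β / 8 := by
    have hden : 0 < lam + μ + 2 := by linarith
    have h : m * K ≤ β / (4 * (lam + μ + 2) * 2) := by
      refine hmK.trans ?_
      gcongr
    rw [le_div_iff₀ (by positivity)] at h
    linarith
  have hmKβ : 32 * (m * K) ≤ β := by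
    linarith [mul_le_mul_of_nonneg_left (show 4 ≤ lam + μ + 2 by linarith) hmK0.le]
  have hmKlam : m * K * lam ≤ β / 8 := by
    linarith [mul_le_mul_of_nonneg_left (show lam ≤ lam + μ + 2 by linarith) hmK0.le]
  have hθ : ∀ i t, 0 ≤ t → HasDerivAt (θ i) (deriv (θ i) t) t := fun i t _ =>
    ((hsmooth i).differentiable (by norm_num) t).hasDerivAt
  have hv : ∀ i t, 0 ≤ t → HasDerivAt (deriv (θ i))
      ((ω + K / N * ∑ j, sin (θ j t - θ i t) - deriv (θ i) t) / m) t := by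
    intro i t ht
    have hC : ContDiff ℝ 1 (deriv (θ i)) := (contDiff_succ_iff_deriv (n := 1).1 (hsmooth i)).2.2
    refine (hC.differentiable (by norm_num) t).hasDerivAt.congr_deriv ?_
    rw [← hode i t ht]
    field_simp
    ring
  have hvel : ∀ i j t, 0 ≤ t → m * (deriv (θ i) t - deriv (θ j) t) ≤ m * K * lam := by
    intro i j t ht
    have h := velocity_diff_le (v := fun i => deriv (θ i)) hm hv
      (fun i j t _ => forceDiff_le_two hK _ i j) i j ht
    have h0 := sub_le_diam (fun i => deriv (θ i) 0) i j
    have hE := exp_pos (-((t - 0) / m))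
    have hE1 : exp (-((t - 0) / m)) ≤ 1 :=
      exp_le_one_iff.2 (neg_nonpos.2 (div_nonneg (by linarith) hm.le))
    have h2 : K * 2 ≤ K * lam := mul_le_mul_of_nonneg_left (by linarith) hK.le
    have h3 := mul_le_mul_of_nonneg_right
      (show deriv (θ i) 0 - deriv (θ j) 0 - K * 2 ≤ K * lam - K * 2 by linarith) hE.le
    have h4 := mul_le_of_le_one_right (show 0 ≤ K * lam - K * 2 by linarith) hE1
    rw [mul_assoc]
    exact mul_le_mul_of_nonneg_left (by linarith) hm.le
  obtain ⟨ε, hεdef⟩ : ∃ ε, ε = m * K * lam := ⟨_, rfl⟩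
  have hε : 0 < ε := by rw [hεdef]; positivity
  rw [← hεdef] at hmKlam hvel
  obtain ⟨c, hc, hdecay⟩ := auxiliary_diam_decay (v := fun i => deriv (θ i))
    (Y := π - α - β + ε) hm hK hε (by linarith) (by linarith) hθ hv hvel
    (fun i j => by linarith [sub_le_diam (fun i => θ i 0) i j, hvel i j 0 le_rfl])
  have hconf : ∀ᶠ t in atTop, ∀ i j, θ i t - θ j t ≤ π - α - β + 2 * ε := by
    filter_upwards [eventually_ge_atTop 0] with t ht i j
    have hE1 : exp (-(c * (t - 0))) ≤ 1 :=
      exp_le_one_iff.2 (neg_nonpos.2 (mul_nonneg hc.le (by linarith)))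
    have hE := mul_le_of_le_one_right (show 0 ≤ π - α - β + ε - 2 * ε by linarith) hE1
    linarith [hdecay i j t ht, hvel j i t ht]
  have hmargin : 8 * (m * K) * (π - α - β + 2 * ε) ≤ 8 * (m * K) * 4 :=
    mul_le_mul_of_nonneg_left (by linarith) (by positivity)
  exact tendsto_phase_diff_zero_of_confined (v := fun i => deriv (θ i)) hm hK (by linarith)
    (by linarith) (by linarith) hθ hv hconf
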